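/- arXiv:1411.1165 — 8 statements merged into one kernel-verified Lean document; each statement's English description precedes it below -/
import Mathlib

section
/- For every natural number n, e^{−1}/(n+1)! < 1 − e^{−1} ∑_{j=0}^n 1/j! < (e^{−1}/(n+1)!) · (1 + (e−1)/(n+2)). -/
open scoped BigOperators ENNReal

/-- A probability mass function on ℕ. -/
def IsPmf (p : ℕ → ℝ) : Prop := (∀ j, 0 ≤ p j) ∧ ∑' j, p j = 1

/-- Total variation distance between two pmfs on ℕ. -/
noncomputable def dtv (p q : ℕ → ℝ) : ℝ := (1 / 2) * ∑' j, |p j - q j|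

/-- Descending factorial (j)_k = j(j-1)⋯(j-k+1), as a real number. -/
noncomputable def descFac (j k : ℕ) : ℝ := ∏ i ∈ Finset.range k, ((j : ℝ) - i)

/-- k-th descending factorial moment of a pmf p. -/
noncomputable def facMoment (k : ℕ) (p : ℕ → ℝ) : ℝ := ∑' j, descFac j k * p j

/-- Factorial moment distance of order α, with values in [0,∞]:
    d_α(p,q) = ∑_{k=1}^∞ (α^{k-1}/k!) |M_k(p) - M_k(q)|. -/
noncomputable def dFM (α : ℝ) (p q : ℕ → ℝ) : ℝ≥0∞ :=
  ∑' k : ℕ, ENNReal.ofReal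
    (α ^ k / (Nat.factorial (k + 1) : ℝ) * |facMoment (k + 1) p - facMoment (k + 1) q|)

/-- The Poisson(λ) pmf. -/
noncomputable def poissonPmf (lam : ℝ) (j : ℕ) : ℝ :=
  Real.exp (-lam) * lam ^ j / (Nat.factorial j : ℝ)

/-- The generalized matching pmf p_{n;λ}. -/
noncomputable def genMatch (n : ℕ) (lam : ℝ) (j : ℕ) : ℝ :=
  if j ≤ n then
    lam ^ j / (Nat.factorial j : ℝ) * ∑ i ∈ Finset.range (n - j + 1), (-lam) ^ i / (Nat.factorial i : ℝ)
  else 0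

theorem hasSum_one_div_factorial_tail (m : ℕ) :
    HasSum (fun k : ℕ => (1 : ℝ) / (Nat.factorial (k + m) : ℝ))
      (Real.exp 1 - ∑ j ∈ Finset.range m, (1 : ℝ) / (Nat.factorial j : ℝ)) := by
  have h : HasSum (fun k : ℕ => (1 : ℝ) / (Nat.factorial k : ℝ)) (Real.exp 1) := by
    simpa [Real.exp_eq_exp_ℝ] using NormedSpace.expSeries_div_hasSum_exp (1 : ℝ)
  exact (hasSum_nat_add_iff' m).2 h

theorem factorial_mul_factorial_succ_le (m k : ℕ) (hm : 1 ≤ m) :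
    Nat.factorial m * Nat.factorial (k + 1) ≤ Nat.factorial (k + m) := by
  induction k with
  | zero => simp
  | succ k ih =>
    rw [Nat.factorial_succ (k + 1), show k + 1 + m = (k + m) + 1 by ring,
      Nat.factorial_succ (k + m)]
    calc Nat.factorial m * ((k + 1 + 1) * Nat.factorial (k + 1))
        = (k + 1 + 1) * (Nat.factorial m * Nat.factorial (k + 1)) := by ring
      _ ≤ (k + m + 1) * Nat.factorial (k + m) := Nat.mul_le_mul (by omega) ih

theorem exp_one_sub_sum_range_pos (m : ℕ) :
    0 < Real.exp 1 - ∑ j ∈ Finset.range m, (1 : ℝ) / (Nat.factorial j : ℝ) := by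
  have h := hasSum_one_div_factorial_tail m
  rw [← h.tsum_eq]
  exact h.summable.tsum_pos (fun k => by positivity) 0 (by positivity)

theorem exp_one_sub_sum_range_lt (m : ℕ) (hm : 2 ≤ m) :
    Real.exp 1 - ∑ j ∈ Finset.range m, (1 : ℝ) / (Nat.factorial j : ℝ)
      < (Real.exp 1 - 1) / (Nat.factorial m : ℝ) := by
  have h := (hasSum_one_div_factorial_tail 1).div_const (Nat.factorial m : ℝ)
  simp only [Finset.sum_range_one, Nat.factorial_zero, Nat.cast_one, div_one] at h
  refine hasSum_lt (i := 1) (fun k => ?_) ?_ (hasSum_one_div_factorial_tail m) h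
  · rw [div_div]
    refine one_div_le_one_div_of_le (by positivity) ?_
    rw [mul_comm]
    exact_mod_cast factorial_mul_factorial_succ_le m k (by omega)
  · rw [div_div]
    refine one_div_lt_one_div_of_lt (by positivity) ?_
    rw [add_comm 1 m, Nat.factorial_succ m]
    have : Nat.factorial (1 + 1) * Nat.factorial m < (m + 1) * Nat.factorial m :=
      Nat.mul_lt_mul_of_pos_right (by simp; omega) (Nat.factorial_pos m)
    exact_mod_cast this

theorem stmt2 (n : ℕ) :
    Real.exp (-1) / (Nat.factorial (n + 1) : ℝ)
      < 1 - Real.exp (-1) * ∑ j ∈ Finset.range (n + 1), (1 : ℝ) / (Nat.factorial j : ℝ) ∧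
    1 - Real.exp (-1) * ∑ j ∈ Finset.range (n + 1), (1 : ℝ) / (Nat.factorial j : ℝ)
      < Real.exp (-1) / (Nat.factorial (n + 1) : ℝ)
          * (1 + (Real.exp 1 - 1) / ((n : ℝ) + 2)) := by
  have hpos := exp_one_sub_sum_range_pos (n + 2)
  have hlt := exp_one_sub_sum_range_lt (n + 2) (by omega)
  rw [Finset.sum_range_succ] at hpos hlt
  set S := ∑ j ∈ Finset.range (n + 1), (1 : ℝ) / (Nat.factorial j : ℝ)
  have hexp : Real.exp (-1) * Real.exp 1 = 1 := by rw [← Real.exp_add]; simp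
  have hmid : 1 - Real.exp (-1) * S = Real.exp (-1) * (Real.exp 1 - S) := by
    rw [mul_sub, hexp]
  have hfac : (Real.exp 1 - 1) / (Nat.factorial (n + 2) : ℝ)
      = 1 / (Nat.factorial (n + 1) : ℝ) * ((Real.exp 1 - 1) / ((n : ℝ) + 2)) := by
    rw [Nat.factorial_succ (n + 1), div_mul_div_comm, one_mul]
    push_cast
    ring
  rw [hfac] at hlt
  rw [hmid, div_eq_mul_one_div, mul_assoc]
  constructor
  · exact mul_lt_mul_of_pos_left (by linarith) (Real.exp_pos _)
  · exact mul_lt_mul_of_pos_left (by linarith) (Real.exp_pos _)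
end

section
/- For each n ≥ 1 let p_n be the pmf on ℕ with p_n(j) = 1 − 1/n if j = 0, 1/n if j = n, and 0 otherwise, and let δ0 be the point mass at 0. Then d_tv(p_n, δ0) = 1/n → 0 as n → ∞, while for every α > 0, d_α(p_n, δ0) ≥ (α/2)(n−1) for all n ≥ 2, so d_α(p_n, δ0) → ∞ as n → ∞. Hence convergence in total variation does not imply convergence in factorial moment distance. -/
open scoped BigOperators ENNReal

/-- The total variation distance between `(1 - 1/n) δ₀ + (1/n) δₙ` and `δ₀` is `1/n`. -/
lemma dtv_two_point_zero {n : ℕ} (hn : n ≠ 0) :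
    dtv (fun j => if j = 0 then 1 - 1 / (n : ℝ) else if j = n then 1 / (n : ℝ) else 0)
      (fun j => if j = 0 then (1 : ℝ) else 0) = 1 / (n : ℝ) := by
  rw [dtv, tsum_eq_sum (s := {0, n}), Finset.sum_pair hn.symm]
  · simp [hn]
    ring
  · intro j hj
    simp only [Finset.mem_insert, Finset.mem_singleton, not_or] at hj
    simp [hj.1, hj.2]

lemma descFac_zero_succ (k : ℕ) : descFac 0 (k + 1) = 0 := by
  simp [descFac, Finset.prod_range_succ']

lemma facMoment_succ_two_point (n k : ℕ) (hn : n ≠ 0) (a b : ℝ) :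
    facMoment (k + 1) (fun j => if j = 0 then a else if j = n then b else 0)
      = descFac n (k + 1) * b := by
  rw [facMoment, tsum_eq_single n]
  · simp [hn]
  · intro j hj
    rcases eq_or_ne j 0 with rfl | h0
    · simp [descFac_zero_succ]
    · simp [h0, hj]

lemma facMoment_succ_zero_point (k : ℕ) :
    facMoment (k + 1) (fun j => if j = 0 then (1 : ℝ) else 0) = 0 := by
  rw [facMoment, tsum_eq_single 0]
  · simp [descFac_zero_succ]
  · intro j hj
    simp [hj]

/-- The second factorial moment alone bounds the factorial moment distance from below. -/
lemma le_dFM_two_point_zero {α : ℝ} {n : ℕ} (hn : n ≠ 0) :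
    ENNReal.ofReal (α / 2 * ((n : ℝ) - 1)) ≤
      dFM α (fun j => if j = 0 then 1 - 1 / (n : ℝ) else if j = n then 1 / (n : ℝ) else 0)
        (fun j => if j = 0 then (1 : ℝ) else 0) := by
  refine le_trans (le_of_eq ?_) (ENNReal.le_tsum 1)
  have h1 : (1 : ℝ) ≤ n := by exact_mod_cast Nat.one_le_iff_ne_zero.mpr hn
  have hmoment : descFac n 2 * (1 / (n : ℝ)) = n - 1 := by
    simp only [descFac, Finset.prod_range_succ, Finset.prod_range_zero]
    push_cast
    field_simp
    ring
  rw [facMoment_succ_two_point n 1 hn, facMoment_succ_zero_point, hmoment, sub_zero,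
    abs_of_nonneg (by linarith)]
  norm_num

theorem stmt5 (p : ℕ → ℕ → ℝ)
    (hp : ∀ n j, p n j = if j = 0 then 1 - 1 / (n : ℝ) else if j = n then 1 / (n : ℝ) else 0) :
    (∀ n : ℕ, 1 ≤ n → dtv (p n) (fun j => if j = 0 then (1 : ℝ) else 0) = 1 / (n : ℝ)) ∧
    Filter.Tendsto (fun n => dtv (p n) (fun j => if j = 0 then (1 : ℝ) else 0))
      Filter.atTop (nhds 0) ∧
    (∀ α : ℝ, 0 < α →
      (∀ n : ℕ, 2 ≤ n →
        ENNReal.ofReal (α / 2 * ((n : ℝ) - 1))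
          ≤ dFM α (p n) (fun j => if j = 0 then (1 : ℝ) else 0)) ∧
      Filter.Tendsto (fun n => dFM α (p n) (fun j => if j = 0 then (1 : ℝ) else 0))
        Filter.atTop (nhds ⊤)) := by
  have hpn : ∀ n, p n =
      fun j => if j = 0 then 1 - 1 / (n : ℝ) else if j = n then 1 / (n : ℝ) else 0 :=
    fun n => funext (hp n)
  have htv : ∀ n : ℕ, 1 ≤ n →
      dtv (p n) (fun j => if j = 0 then (1 : ℝ) else 0) = 1 / (n : ℝ) := fun n hn => by
    rw [hpn]
    exact dtv_two_point_zero (by omega)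
  have hlower : ∀ α : ℝ, ∀ n : ℕ, 2 ≤ n → ENNReal.ofReal (α / 2 * ((n : ℝ) - 1))
      ≤ dFM α (p n) (fun j => if j = 0 then (1 : ℝ) else 0) := fun α n hn => by
    rw [hpn]
    exact le_dFM_two_point_zero (by omega)
  refine ⟨htv, ?_, fun α hα => ⟨hlower α, ?_⟩⟩
  · refine tendsto_one_div_atTop_nhds_zero_nat.congr' ?_
    filter_upwards [Filter.eventually_ge_atTop 1] with n hn using (htv n hn).symm
  · have hreal : Filter.Tendsto (fun n : ℕ => α / 2 * ((n : ℝ) - 1)) Filter.atTop Filter.atTop :=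
      (Filter.tendsto_atTop_add_const_right _ (-1)
        tendsto_natCast_atTop_atTop).const_mul_atTop (half_pos hα)
    refine tendsto_nhds_top_mono (ENNReal.tendsto_ofReal_atTop.comp hreal) ?_
    filter_upwards [Filter.eventually_ge_atTop 2] with n hn using hlower α n hn
end

section
/- (Moment inversion formula.) Let p be a probability mass function on ℕ such that ∑_{j=0}^∞ (1+t')^j p(j) < ∞ for some t' > 1. Then for every j ∈ ℕ, p(j) = ∑_{k=j}^∞ ((−1)^{k−j}/k!) · C(k,j) · M_k(p), where C(k,j) is the binomial coefficient and M_k(p) = ∑_{i=0}^∞ (i)_k p(i) is the k-th descending factorial moment of p; in particular the series on the right converges. -/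
open scoped BigOperators ENNReal

theorem descFac_eq_factorial_mul_choose (i k : ℕ) :
    descFac i k = (k.factorial : ℝ) * (i.choose k : ℝ) := by
  rw [← Nat.cast_mul, ← Nat.descFactorial_eq_factorial_mul_choose]
  induction k with
  | zero => simp [descFac]
  | succ k ih =>
    unfold descFac at ih ⊢
    rw [Finset.prod_range_succ, ih, Nat.descFactorial_succ]
    rcases le_or_gt k i with h | h
    · push_cast [Nat.cast_sub h]
      ring
    · simp [Nat.descFactorial_of_lt h]

theorem hasSum_pow_mul_choose (x : ℝ) (n : ℕ) :
    HasSum (fun m : ℕ => x ^ m * (n.choose m : ℝ)) ((x + 1) ^ n) := by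
  have h : (x + 1) ^ n = ∑ m ∈ Finset.range (n + 1), x ^ m * (n.choose m : ℝ) := by
    simp [add_pow]
  rw [h]
  refine hasSum_sum_of_ne_finset_zero fun m hm => ?_
  rw [Nat.choose_eq_zero_of_lt (by simpa using hm)]
  simp

theorem two_pow_sub_mul_choose_le {s : ℝ} (hs : 0 < s) (i j : ℕ) :
    (2 : ℝ) ^ (i - j) * (i.choose j : ℝ) ≤ (s ^ j)⁻¹ * (s + 2) ^ i := by
  rw [inv_mul_eq_div, le_div_iff₀ (by positivity), add_pow]
  rcases le_or_gt j i with h | h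
  · refine le_trans (le_of_eq (by ring)) (Finset.single_le_sum
      (f := fun m => s ^ m * 2 ^ (i - m) * (i.choose m : ℝ)) (fun m _ => by positivity)
      (Finset.mem_range.2 (Nat.lt_succ_of_le h)))
  · rw [Nat.choose_eq_zero_of_lt h]
    simp only [Nat.cast_zero, mul_zero, zero_mul]
    positivity

theorem stmt6 (p : ℕ → ℝ) (hp : IsPmf p)
    (ht : ∃ t' : ℝ, 1 < t' ∧ Summable fun j => (1 + t') ^ j * p j) (j : ℕ) :
    HasSum (fun m : ℕ =>
      (-1 : ℝ) ^ m / (Nat.factorial (j + m) : ℝ) * (Nat.choose (j + m) j : ℝ) * facMoment (j + m) p)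
      (p j) := by
  obtain ⟨t, ht, hsum⟩ := ht
  let F : ℕ × ℕ → ℝ := fun x =>
    (-1) ^ x.2 * ((x.1 - j).choose x.2 : ℝ) * ((x.1.choose j : ℝ) * p x.1)
  have hnorm (i m : ℕ) :
      ‖F (i, m)‖ = 1 ^ m * ((i - j).choose m : ℝ) * ((i.choose j : ℝ) * p i) := by
    simp [F, abs_of_nonneg (hp.1 i)]
  have habs (i : ℕ) :
      HasSum (fun m => ‖F (i, m)‖) (2 ^ (i - j) * ((i.choose j : ℝ) * p i)) := by
    simp only [hnorm]
    have h := (hasSum_pow_mul_choose 1 (i - j)).mul_right ((i.choose j : ℝ) * p i)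
    rwa [one_add_one_eq_two] at h
  have hF : Summable F := by
    refine Summable.of_norm ((summable_prod_of_nonneg fun _ => norm_nonneg _).2
      ⟨fun i => (habs i).summable, ?_⟩)
    simp only [(habs _).tsum_eq]
    refine Summable.of_nonneg_of_le
      (fun i => mul_nonneg (by positivity) (mul_nonneg (by positivity) (hp.1 i))) (fun i => ?_)
      (hsum.mul_left (((t - 1) ^ j)⁻¹))
    have h := mul_le_mul_of_nonneg_right
      (two_pow_sub_mul_choose_le (sub_pos.2 ht) i j) (hp.1 i)
    rw [show t - 1 + 2 = 1 + t by ring] at h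
    simpa only [mul_assoc] using h
  have hrow (i : ℕ) : HasSum (fun m => F (i, m)) (if i = j then p j else 0) := by
    have h : (if i = j then p j else 0) = (-1 + 1) ^ (i - j) * ((i.choose j : ℝ) * p i) := by
      rcases lt_trichotomy i j with h | h | h
      · simp [h.ne, Nat.choose_eq_zero_of_lt h]
      · simp [h]
      · simp [h.ne', (Nat.sub_pos_of_lt h).ne']
    rw [h]
    exact (hasSum_pow_mul_choose (-1) (i - j)).mul_right ((i.choose j : ℝ) * p i)
  have htot : HasSum F (p j) := by
    have h := hF.hasSum.prod_fiberwise hrow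
    rw [← h.unique (hasSum_ite_eq j (p j))]
    exact hF.hasSum
  have hswap := (Equiv.prodComm ℕ ℕ).hasSum_iff.2 htot
  refine (hswap.prod_fiberwise fun m => (hswap.summable.prod_factor m).hasSum).congr_fun ?_
  intro m
  rw [facMoment, ← tsum_mul_left]
  refine tsum_congr fun i => ?_
  have hc : (i.choose (j + m) : ℝ) * ((j + m).choose j : ℝ) =
      (i.choose j : ℝ) * ((i - j).choose m : ℝ) := by
    have h := Nat.choose_mul (n := i) (Nat.le_add_right j m)
    rw [Nat.add_sub_cancel_left] at h
    exact_mod_cast h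
  have hfac : ((j + m).factorial : ℝ) ≠ 0 := by positivity
  rw [descFac_eq_factorial_mul_choose]
  simp only [F, Function.comp_apply, Equiv.prodComm_apply, Prod.swap]
  field_simp
  linear_combination p i * hc
end

section
/- For every natural number n and every λ ∈ (0,1], the generalized matching function p_{n;λ} is a probability mass function on ℕ: p_{n;λ}(j) ≥ 0 for all j ∈ ℕ and ∑_{j=0}^n p_{n;λ}(j) = 1. -/
open scoped BigOperators ENNReal

theorem sum_range_neg_pow_div_factorial_nonneg {x : ℝ} (h0 : 0 ≤ x) (h1 : x ≤ 1) (m : ℕ) :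
    0 ≤ ∑ i ∈ Finset.range m, (-x) ^ i / (Nat.factorial i : ℝ) := by
  have heven : ∀ k : ℕ, 0 ≤ ∑ i ∈ Finset.range (2 * k), (-x) ^ i / (Nat.factorial i : ℝ) := by
    intro k
    induction k with
    | zero => simp
    | succ k ih =>
      rw [show 2 * (k + 1) = 2 * k + 1 + 1 by ring, Finset.sum_range_succ, Finset.sum_range_succ]
      have hpair : x ^ (2 * k + 1) / (Nat.factorial (2 * k + 1) : ℝ)
          ≤ x ^ (2 * k) / (Nat.factorial (2 * k) : ℝ) := by
        have hpow : x ^ (2 * k + 1) ≤ x ^ (2 * k) := pow_le_pow_of_le_one h0 h1 (Nat.le_succ _)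
        have hfac : Nat.factorial (2 * k) ≤ Nat.factorial (2 * k + 1) :=
          Nat.factorial_le (Nat.le_succ _)
        gcongr
      rw [(even_two_mul k).neg_pow, (odd_two_mul_add_one k).neg_pow, neg_div]
      linarith
  obtain ⟨k, rfl | rfl⟩ := Nat.even_or_odd' m
  · exact heven k
  · rw [Finset.sum_range_succ, (even_two_mul k).neg_pow]
    exact add_nonneg (heven k) (by positivity)

theorem sum_range_pow_div_factorial_mul (x y : ℝ) (m : ℕ) :
    ∑ k ∈ Finset.range (m + 1),
      x ^ k / (Nat.factorial k : ℝ) * (y ^ (m - k) / (Nat.factorial (m - k) : ℝ))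
        = (x + y) ^ m / (Nat.factorial m : ℝ) := by
  rw [add_pow, Finset.sum_div]
  refine Finset.sum_congr rfl fun k hk => ?_
  rw [Nat.cast_choose ℝ (Nat.lt_succ_iff.mp (Finset.mem_range.mp hk))]
  field_simp

theorem stmt8 (n : ℕ) (lam : ℝ) (hlam : 0 < lam ∧ lam ≤ 1) :
    (∀ j, 0 ≤ genMatch n lam j) ∧ ∑ j ∈ Finset.range (n + 1), genMatch n lam j = 1 := by
  obtain ⟨h0, h1⟩ := hlam
  constructor
  · intro j
    unfold genMatch
    split_ifs
    · exact mul_nonneg (by positivity) (sum_range_neg_pow_div_factorial_nonneg h0.le h1 _)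
    · exact le_rfl
  · calc ∑ j ∈ Finset.range (n + 1), genMatch n lam j
        = ∑ j ∈ Finset.range (n + 1), ∑ i ∈ Finset.range (n + 1 - j),
            lam ^ j / (Nat.factorial j : ℝ) * ((-lam) ^ i / (Nat.factorial i : ℝ)) := by
          refine Finset.sum_congr rfl fun j hj => ?_
          have hjn : j ≤ n := Nat.lt_succ_iff.mp (Finset.mem_range.mp hj)
          rw [genMatch, if_pos hjn, Finset.mul_sum, Nat.sub_add_comm hjn]
      _ = ∑ m ∈ Finset.range (n + 1), (lam + -lam) ^ m / (Nat.factorial m : ℝ) := by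
          rw [← Finset.sum_range_diag_flip (n + 1)
            fun j i => lam ^ j / (Nat.factorial j : ℝ) * ((-lam) ^ i / (Nat.factorial i : ℝ))]
          exact Finset.sum_congr rfl fun m _ => sum_range_pow_div_factorial_mul lam (-lam) m
      _ = 1 := by
          rw [Finset.sum_range_succ']
          simp
end

section
/- For every natural number n, every λ ∈ (0,1], and every k ≥ 1, the k-th descending factorial moment of the generalized matching pmf p_{n;λ} satisfies ∑_{j=0}^n (j)_k p_{n;λ}(j) = λ^k if k ≤ n, and = 0 if k > n. -/
open scoped BigOperators ENNReal

theorem descFac_eq_cast_descFactorial (j k : ℕ) : descFac j k = (j.descFactorial k : ℝ) := by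
  rw [← descPochhammer_eval_eq_descFactorial ℝ j k, descPochhammer_eval_eq_prod_range, descFac]

/-- The degree-`m` term of the product of the exponential series at `x` and at `-x`. -/
theorem sum_exp_terms_mul_neg (x : ℝ) (m : ℕ) :
    ∑ k ∈ Finset.range (m + 1),
      x ^ k / (k.factorial : ℝ) * ((-x) ^ (m - k) / ((m - k).factorial : ℝ)) =
      if m = 0 then 1 else 0 := by
  have h : ∑ k ∈ Finset.range (m + 1),
      x ^ k / (k.factorial : ℝ) * ((-x) ^ (m - k) / ((m - k).factorial : ℝ)) =
      (x + -x) ^ m / (m.factorial : ℝ) := by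
    rw [add_pow, Finset.sum_div]
    refine Finset.sum_congr rfl fun k hk => ?_
    rw [Nat.cast_choose ℝ (Finset.mem_range_succ_iff.mp hk)]
    have := Nat.factorial_ne_zero m
    field_simp
  rw [h]
  split_ifs with hm
  · simp [hm]
  · simp [hm]

/-- The total mass of the generalized matching pmf. -/
theorem sum_exp_term_mul_partial_sum (x : ℝ) (m : ℕ) :
    ∑ l ∈ Finset.range (m + 1), x ^ l / (l.factorial : ℝ) *
      ∑ i ∈ Finset.range (m + 1 - l), (-x) ^ i / (i.factorial : ℝ) = 1 := by
  simp_rw [Finset.mul_sum]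
  rw [← Finset.sum_range_diag_flip (m + 1)
    fun l i => x ^ l / (l.factorial : ℝ) * ((-x) ^ i / (i.factorial : ℝ))]
  simp [sum_exp_terms_mul_neg]

theorem stmt9 (n : ℕ) (lam : ℝ) (hlam : 0 < lam ∧ lam ≤ 1) (k : ℕ) (hk : 1 ≤ k) :
    ∑ j ∈ Finset.range (n + 1), descFac j k * genMatch n lam j
      = if k ≤ n then lam ^ k else 0 := by
  simp_rw [descFac_eq_cast_descFactorial]
  split_ifs with h
  · obtain ⟨m, rfl⟩ := Nat.exists_eq_add_of_le h
    rw [add_assoc, Finset.sum_range_add, Finset.sum_eq_zero, zero_add,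
      ← mul_one (lam ^ k), ← sum_exp_term_mul_partial_sum lam m, Finset.mul_sum]
    · refine Finset.sum_congr rfl fun l hl => ?_
      have hlm : l ≤ m := Finset.mem_range_succ_iff.mp hl
      have hf : ((k + l).factorial : ℝ) = l.factorial * (k + l).descFactorial k := by
        have := Nat.factorial_mul_descFactorial (Nat.le_add_right k l)
        rw [Nat.add_sub_cancel_left] at this
        exact_mod_cast this.symm
      have hd : ((k + l).descFactorial k : ℝ) ≠ 0 := by
        exact_mod_cast (Nat.descFactorial_pos.mpr (Nat.le_add_right k l)).ne'
      rw [genMatch, if_pos (by lia), show k + m - (k + l) + 1 = m + 1 - l by lia, hf, pow_add]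
      field_simp
    · intro j hj
      simp [Nat.descFactorial_of_lt (Finset.mem_range.mp hj)]
  · refine Finset.sum_eq_zero fun j hj => ?_
    have hj' : j < k := by
      have := Finset.mem_range.mp hj
      lia
    simp [Nat.descFactorial_of_lt hj']
end

section
/- Let n ≥ 2 and λ > 1. Then there is no probability mass function p on ℕ supported on {0,1,…,n} whose descending factorial moments satisfy ∑_{j=0}^n (j)_k p(j) = λ^k for all 1 ≤ k ≤ n. Equivalently: if a pmf p supported on {0,1,…,n} satisfies M_k(p) = λ^k for all 1 ≤ k ≤ n with λ > 0, then λ ≤ 1. -/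
open scoped BigOperators ENNReal

theorem descFac_eq_zero_of_lt {j k : ℕ} (h : j < k) : descFac j k = 0 :=
  Finset.prod_eq_zero (Finset.mem_range.mpr h) (sub_self _)

theorem descFac_self_nonneg (k : ℕ) : 0 ≤ descFac k k :=
  Finset.prod_nonneg fun _ hi =>
    sub_nonneg.mpr (Nat.cast_le.mpr (Finset.mem_range.mp hi).le)

theorem descFac_succ_self (k : ℕ) : descFac (k + 1) (k + 1) = descFac (k + 1) k := by
  rw [descFac, Finset.prod_range_succ, ← descFac]
  push_cast
  ring

theorem sum_range_descFac_mul_eq_zero (k : ℕ) (p : ℕ → ℝ) :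
    ∑ j ∈ Finset.range k, descFac j k * p j = 0 :=
  Finset.sum_eq_zero fun _ hj => by
    rw [descFac_eq_zero_of_lt (Finset.mem_range.mp hj), zero_mul]

theorem stmt12 (n : ℕ) (hn : 2 ≤ n) (lam : ℝ) (hlam : 0 < lam)
    (p : ℕ → ℝ) (hp : IsPmf p) (hsupp : ∀ j, n < j → p j = 0)
    (hmom : ∀ k, 1 ≤ k → k ≤ n →
      ∑ j ∈ Finset.range (n + 1), descFac j k * p j = lam ^ k) :
    lam ≤ 1 := by
  obtain ⟨m, rfl⟩ : ∃ m, n = m + 1 := ⟨n - 1, by omega⟩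
  have htop := hmom (m + 1) (by omega) le_rfl
  have hpred := hmom m (by omega) (by omega)
  rw [Finset.sum_range_succ, sum_range_descFac_mul_eq_zero, zero_add, descFac_succ_self] at htop
  rw [Finset.sum_range_succ, Finset.sum_range_succ, sum_range_descFac_mul_eq_zero, zero_add,
    htop] at hpred
  have hnonneg : 0 ≤ descFac m m * p m := mul_nonneg (descFac_self_nonneg m) (hp.1 m)
  have hle : lam ^ m * lam ≤ lam ^ m * 1 := by
    rw [← pow_succ]
    linarith
  exact le_of_mul_le_mul_left hle (pow_pos hlam m)
end

section
/- For every natural number n, the total variation distance between the classical matching distribution p_{n;1} and the Poisson(1) pmf q_1 satisfies d_tv(p_{n;1}, q_1) < (2^n/(n+1)!) · (1 + 2/(n+2) + 4e²/((n+2)(n+3))). -/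
open scoped BigOperators ENNReal

/-- The error of a partial sum of the alternating series `∑ (-1)^i / i!` for `e⁻¹` is at most the
first omitted term. -/
theorem abs_sum_neg_one_pow_div_factorial_sub_exp_neg_one_le (m : ℕ) :
    |∑ i ∈ Finset.range m, (-1 : ℝ) ^ i / (Nat.factorial i : ℝ) - Real.exp (-1)|
      ≤ 1 / (Nat.factorial m : ℝ) := by
  have hlim : Filter.Tendsto
      (fun n ↦ ∑ i ∈ Finset.range n, (-1 : ℝ) ^ i * (1 / (Nat.factorial i : ℝ)))
      Filter.atTop (nhds (Real.exp (-1))) := by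
    have h := (NormedSpace.expSeries_div_hasSum_exp (-1 : ℝ)).tendsto_sum_nat
    rw [← Real.exp_eq_exp_ℝ] at h
    simpa [div_eq_mul_inv] using h
  have hanti : Antitone (fun i : ℕ ↦ 1 / (Nat.factorial i : ℝ)) := fun a b hab ↦
    one_div_le_one_div_of_le (by positivity) (by exact_mod_cast Nat.factorial_le hab)
  simp only [div_eq_mul_one_div ((-1 : ℝ) ^ _)]
  obtain ⟨k, rfl | rfl⟩ := Nat.even_or_odd' m
  · have h1 := hanti.alternating_series_le_tendsto hlim k
    have h2 := hanti.tendsto_le_alternating_series hlim k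
    rw [Finset.sum_range_succ, pow_mul] at h2
    norm_num only [one_pow] at h1 h2 ⊢
    rw [abs_le]
    constructor <;> linarith
  · have h1 := hanti.alternating_series_le_tendsto hlim (k + 1)
    have h2 := hanti.tendsto_le_alternating_series hlim k
    rw [show 2 * (k + 1) = 2 * k + 1 + 1 by ring, Finset.sum_range_succ, pow_succ, pow_mul] at h1
    norm_num only [one_pow] at h1 h2 ⊢
    rw [abs_le]
    constructor <;> linarith

theorem abs_genMatch_one_sub_poissonPmf_one_le {n j : ℕ} (hj : j ≤ n) :
    |genMatch n 1 j - poissonPmf 1 j|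
      ≤ ((n + 1).choose j : ℝ) / (Nat.factorial (n + 1) : ℝ) := by
  have h := abs_sum_neg_one_pow_div_factorial_sub_exp_neg_one_le (n - j + 1)
  have hc : ((n + 1).choose j : ℝ) / (Nat.factorial (n + 1) : ℝ)
      = 1 / (Nat.factorial j : ℝ) * (1 / (Nat.factorial (n - j + 1) : ℝ)) := by
    rw [Nat.cast_choose ℝ (by lia : j ≤ n + 1), Nat.sub_add_comm hj]
    field_simp
  rw [genMatch, if_pos hj, poissonPmf, one_pow, mul_one, hc,
    div_eq_mul_one_div (Real.exp (-1)), mul_comm (Real.exp (-1)), ← mul_sub, abs_mul,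
    abs_of_nonneg (by positivity : (0 : ℝ) ≤ 1 / (Nat.factorial j : ℝ))]
  gcongr

theorem hasSum_poissonPmf (lam : ℝ) : HasSum (poissonPmf lam) 1 := by
  have h := (NormedSpace.expSeries_div_hasSum_exp lam).mul_left (Real.exp (-lam))
  rw [← Real.exp_eq_exp_ℝ, ← Real.exp_add, neg_add_cancel, Real.exp_zero] at h
  simp only [← mul_div_assoc] at h
  exact h

theorem poissonPmf_one_add_le (m j : ℕ) :
    poissonPmf 1 (j + m) ≤ poissonPmf 1 j * (1 / (Nat.factorial m : ℝ)) := by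
  have h : (Nat.factorial j * Nat.factorial m : ℝ) ≤ Nat.factorial (j + m) := by
    exact_mod_cast Nat.le_of_dvd (Nat.factorial_pos _)
      (Nat.factorial_mul_factorial_dvd_factorial_add j m)
  simp only [poissonPmf, one_pow, mul_one, div_mul_div_comm]
  gcongr

theorem abs_genMatch_sub_poissonPmf_add (n j : ℕ) :
    |genMatch n 1 (j + (n + 1)) - poissonPmf 1 (j + (n + 1))| = poissonPmf 1 (j + (n + 1)) := by
  rw [genMatch, if_neg (by lia), zero_sub, abs_neg, abs_of_nonneg]
  unfold poissonPmf
  positivity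

theorem dtv_genMatch_one_poissonPmf_one_le (n : ℕ) :
    dtv (genMatch n 1) (poissonPmf 1) ≤ 2 ^ n / (Nat.factorial (n + 1) : ℝ) := by
  have htail : Summable (fun j ↦ poissonPmf 1 (j + (n + 1))) :=
    (summable_nat_add_iff (n + 1)).2 (hasSum_poissonPmf 1).summable
  have hsum : Summable (fun j ↦ |genMatch n 1 j - poissonPmf 1 j|) := by
    rw [← summable_nat_add_iff (n + 1)]
    simpa only [abs_genMatch_sub_poissonPmf_add] using htail
  have hhead : ∑ j ∈ Finset.range (n + 1), |genMatch n 1 j - poissonPmf 1 j|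
      ≤ (2 ^ (n + 1) - 1) / (Nat.factorial (n + 1) : ℝ) := by
    have hc : ∑ j ∈ Finset.range (n + 1), ((n + 1).choose j : ℝ) = 2 ^ (n + 1) - 1 := by
      have h : ∑ j ∈ Finset.range (n + 1 + 1), ((n + 1).choose j : ℝ) = 2 ^ (n + 1) := by
        exact_mod_cast Nat.sum_range_choose (n + 1)
      rw [Finset.sum_range_succ, Nat.choose_self, Nat.cast_one] at h
      linarith
    rw [← hc, Finset.sum_div]
    exact Finset.sum_le_sum fun j hj ↦
      abs_genMatch_one_sub_poissonPmf_one_le (Nat.lt_succ_iff.1 (Finset.mem_range.1 hj))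
  have hrest : ∑' j, poissonPmf 1 (j + (n + 1)) ≤ 1 / (Nat.factorial (n + 1) : ℝ) := by
    have h := (hasSum_poissonPmf 1).mul_right (1 / (Nat.factorial (n + 1) : ℝ))
    rw [one_mul] at h
    exact hasSum_le (poissonPmf_one_add_le (n + 1)) htail.hasSum h
  rw [dtv, ← hsum.sum_add_tsum_nat_add (n + 1)]
  simp only [abs_genMatch_sub_poissonPmf_add]
  calc _ ≤ 1 / 2 * ((2 ^ (n + 1) - 1) / (Nat.factorial (n + 1) : ℝ)
        + 1 / (Nat.factorial (n + 1) : ℝ)) := by gcongr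
    _ = _ := by ring

theorem stmt16 (n : ℕ) :
    dtv (genMatch n 1) (poissonPmf 1)
      < 2 ^ n / (Nat.factorial (n + 1) : ℝ)
          * (1 + 2 / ((n : ℝ) + 2) + 4 * Real.exp 2 / (((n : ℝ) + 2) * ((n : ℝ) + 3))) := by
  refine (dtv_genMatch_one_poissonPmf_one_le n).trans_lt (lt_mul_of_one_lt_right (by positivity) ?_)
  rw [add_assoc]
  exact lt_add_of_pos_right 1 (by positivity)
end

section
/- For every λ ∈ (0,1] and natural number n, the total variation distance d_tv(n) = d_tv(p_{n;λ}, q_λ) between the generalized matching pmf and the Poisson(λ) pmf satisfies d_tv(n) = (λ^{n+1}/(2·n!)) ∫_0^1 [y^n + (2−y)^n] e^{−λy} dy. -/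
open scoped BigOperators ENNReal

theorem mul_integral_one_sub_pow_succ_mul_exp (x : ℝ) (m : ℕ) :
    x * ∫ t in (0 : ℝ)..1, (1 - t) ^ (m + 1) * Real.exp (x * t)
      = (m + 1) * (∫ t in (0 : ℝ)..1, (1 - t) ^ m * Real.exp (x * t)) - 1 := by
  have hderiv (t : ℝ) : HasDerivAt (fun t : ℝ => (1 - t) ^ (m + 1) * Real.exp (x * t))
      (x * ((1 - t) ^ (m + 1) * Real.exp (x * t))
        - (m + 1) * ((1 - t) ^ m * Real.exp (x * t))) t := by
    have h1 := ((hasDerivAt_id t).const_sub 1).pow (m + 1)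
    have h2 := ((hasDerivAt_id t).const_mul x).exp
    refine (h1.mul h2).congr_deriv ?_
    simp
    ring
  have hint := intervalIntegral.integral_eq_sub_of_hasDerivAt (a := 0) (b := 1)
    (fun t _ => hderiv t) (Continuous.intervalIntegrable (by fun_prop) _ _)
  rw [intervalIntegral.integral_sub (Continuous.intervalIntegrable (by fun_prop) _ _)
    (Continuous.intervalIntegrable (by fun_prop) _ _),
    intervalIntegral.integral_const_mul, intervalIntegral.integral_const_mul] at hint
  simp at hint
  linarith

/-- Taylor expansion of the exponential at `0` with integral remainder. -/
theorem exp_sub_sum_range_eq_integral (x : ℝ) (m : ℕ) :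
    Real.exp x - ∑ i ∈ Finset.range (m + 1), x ^ i / (Nat.factorial i : ℝ)
      = x ^ (m + 1) / (Nat.factorial m : ℝ)
          * ∫ t in (0 : ℝ)..1, (1 - t) ^ m * Real.exp (x * t) := by
  induction m with
  | zero => simp
  | succ m ih =>
    rw [Finset.sum_range_succ, ← sub_sub, ih, pow_succ x (m + 1), mul_div_right_comm, mul_assoc,
      mul_integral_one_sub_pow_succ_mul_exp, Nat.factorial_succ]
    have := Nat.factorial_ne_zero m
    push_cast
    generalize (∫ t in (0 : ℝ)..1, (1 - t) ^ m * Real.exp (x * t)) = I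
    field_simp

theorem abs_genMatch_sub_poissonPmf {lam : ℝ} (hlam : 0 ≤ lam) {n j : ℕ} (hj : j ≤ n) :
    |genMatch n lam j - poissonPmf lam j|
      = lam ^ (n + 1) / (Nat.factorial n : ℝ)
          * ∫ t in (0 : ℝ)..1, (1 - t) ^ (n - j) * (n.choose j : ℝ) * Real.exp (-(lam * t)) := by
  have hrem := exp_sub_sum_range_eq_integral (-lam) (n - j)
  simp only [neg_mul] at hrem
  have hnonneg : 0 ≤ ∫ t in (0 : ℝ)..1, (1 - t) ^ (n - j) * Real.exp (-(lam * t)) :=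
    intervalIntegral.integral_nonneg zero_le_one fun t ht =>
      mul_nonneg (pow_nonneg (sub_nonneg.2 ht.2) _) (Real.exp_pos _).le
  have hchoose : (∫ t in (0 : ℝ)..1,
      (1 - t) ^ (n - j) * (n.choose j : ℝ) * Real.exp (-(lam * t)))
      = n.choose j * ∫ t in (0 : ℝ)..1, (1 - t) ^ (n - j) * Real.exp (-(lam * t)) := by
    rw [← intervalIntegral.integral_const_mul]
    congr 1
    ext t
    ring
  have hdiff : genMatch n lam j - poissonPmf lam j = -(lam ^ j / (Nat.factorial j : ℝ)
      * (Real.exp (-lam)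
        - ∑ i ∈ Finset.range (n - j + 1), (-lam) ^ i / (Nat.factorial i : ℝ))) := by
    simp only [genMatch, poissonPmf, if_pos hj]
    ring
  rw [hdiff, hrem, hchoose, Nat.cast_choose ℝ hj, abs_neg, abs_mul, abs_mul, abs_div, abs_div,
    abs_pow, abs_pow, abs_neg, abs_of_nonneg hlam, abs_of_nonneg hnonneg, Nat.abs_cast,
    Nat.abs_cast]
  have hpow : lam ^ (n + 1) = lam ^ j * lam ^ (n - j + 1) := by
    rw [← pow_add]
    congr 1
    omega
  have := Nat.factorial_ne_zero n
  rw [hpow]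
  generalize (∫ t in (0 : ℝ)..1, (1 - t) ^ (n - j) * Real.exp (-(lam * t))) = I
  field_simp

theorem sum_abs_genMatch_sub_poissonPmf {lam : ℝ} (hlam : 0 ≤ lam) (n : ℕ) :
    ∑ j ∈ Finset.range (n + 1), |genMatch n lam j - poissonPmf lam j|
      = lam ^ (n + 1) / (Nat.factorial n : ℝ)
          * ∫ y in (0 : ℝ)..1, (2 - y) ^ n * Real.exp (-(lam * y)) := by
  rw [Finset.sum_congr rfl fun j hj =>
      abs_genMatch_sub_poissonPmf hlam (Nat.lt_succ_iff.1 (Finset.mem_range.1 hj)),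
    ← Finset.mul_sum, ← intervalIntegral.integral_finsetSum
      fun j _ => Continuous.intervalIntegrable (by fun_prop) _ _]
  congr 2
  ext t
  rw [← Finset.sum_mul, show 2 - t = 1 + (1 - t) by ring, add_pow]
  simp

theorem tsum_poissonPmf_nat_add (lam : ℝ) (n : ℕ) :
    ∑' j, poissonPmf lam (j + (n + 1))
      = lam ^ (n + 1) / (Nat.factorial n : ℝ)
          * ∫ y in (0 : ℝ)..1, y ^ n * Real.exp (-(lam * y)) := by
  have hsplit := (hasSum_poissonPmf lam).summable.sum_add_tsum_nat_add (n + 1)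
  rw [(hasSum_poissonPmf lam).tsum_eq] at hsplit
  have hhead : ∑ j ∈ Finset.range (n + 1), poissonPmf lam j
      = Real.exp (-lam) * ∑ j ∈ Finset.range (n + 1), lam ^ j / (Nat.factorial j : ℝ) := by
    simp only [poissonPmf, Finset.mul_sum, mul_div_assoc]
  have hreflect : ∫ y in (0 : ℝ)..1, y ^ n * Real.exp (-(lam * y))
      = Real.exp (-lam) * ∫ t in (0 : ℝ)..1, (1 - t) ^ n * Real.exp (lam * t) := by
    have h := intervalIntegral.integral_comp_sub_left (a := 0) (b := 1)
      (fun y : ℝ => y ^ n * Real.exp (-(lam * y))) 1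
    rw [sub_self, sub_zero] at h
    rw [← h, ← intervalIntegral.integral_const_mul]
    congr 1
    ext t
    rw [mul_left_comm, ← Real.exp_add]
    ring_nf
  have hexp : Real.exp (-lam) * Real.exp lam = 1 := by
    rw [← Real.exp_add, neg_add_cancel, Real.exp_zero]
  rw [hreflect, mul_left_comm, ← exp_sub_sum_range_eq_integral, mul_sub, hexp, ← hhead]
  linarith

theorem stmt17 (lam : ℝ) (hlam : 0 < lam ∧ lam ≤ 1) (n : ℕ) :
    dtv (genMatch n lam) (poissonPmf lam)
      = lam ^ (n + 1) / (2 * (Nat.factorial n : ℝ))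
          * ∫ y in (0 : ℝ)..1, (y ^ n + (2 - y) ^ n) * Real.exp (-(lam * y)) := by
  have htail (j : ℕ) : |genMatch n lam (j + (n + 1)) - poissonPmf lam (j + (n + 1))|
      = poissonPmf lam (j + (n + 1)) := by
    have hpos : 0 ≤ poissonPmf lam (j + (n + 1)) := by
      have := hlam.1
      unfold poissonPmf
      positivity
    rw [genMatch, if_neg (by omega), zero_sub, abs_neg, abs_of_nonneg hpos]
  have hsummable : Summable fun j => |genMatch n lam j - poissonPmf lam j| := by
    refine (summable_nat_add_iff (n + 1)).1 ?_
    simp only [htail]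
    exact (summable_nat_add_iff (n + 1)).2 (hasSum_poissonPmf lam).summable
  simp only [add_mul]
  rw [intervalIntegral.integral_add (Continuous.intervalIntegrable (by fun_prop) _ _)
    (Continuous.intervalIntegrable (by fun_prop) _ _)]
  rw [dtv, ← hsummable.sum_add_tsum_nat_add (n + 1), tsum_congr htail,
    tsum_poissonPmf_nat_add, sum_abs_genMatch_sub_poissonPmf hlam.1.le]
  ring
end
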